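/- Fix n ≥ 2 and functions a, b, w : Fin n → ℕ with a i ≥ 1 and b i ≥ 1 for all i, w 0 = b 0, and 1 ≤ w i ≤ b i for all i with 1 ≤ i ≤ n−2. A vertex v of Q′ ⊗ Q″ is diagonal if and only if either both coordinates of v lie in layer 0, or there exists a vertex with both coordinates in layer 0 from which v is reachable by a directed walk in Q′ ⊗ Q″. -/

import Mathlib

/-- Tensor product of digraphs. -/
def Digraph.tensor {V₁ V₂ : Type*} (D₁ : Digraph V₁) (D₂ : Digraph V₂) :
    Digraph (V₁ × V₂) where
  Adj u v := D₁.Adj u.1 v.1 ∧ D₂.Adj u.2 v.2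

/-- Induced subdigraph on a set of vertices. -/
def Digraph.induce {V : Type*} (D : Digraph V) (S : Set V) : Digraph S where
  Adj u v := D.Adj u v

/-- The paper's `n`-partite graph `B(X₁,…,Xₙ)`: layer `i` is the grid
`Fin (a i) × Fin (b i)`, with an arc from the layer-`i` vertex `(p,q)` to every
layer-`(i+1)` vertex exactly when `q < w i`. -/
def Lgraph (n : ℕ) (a b w : Fin n → ℕ) :
    Digraph (Σ i : Fin n, Fin (a i) × Fin (b i)) where
  Adj u v := (v.1 : ℕ) = (u.1 : ℕ) + 1 ∧ (u.2.2 : ℕ) < w u.1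

/-- The row contraction Q′ of `Lgraph`: an arc from every layer-`i` vertex to
every layer-`(i+1)` vertex. -/
def Qrow (n : ℕ) (a : Fin n → ℕ) : Digraph (Σ i : Fin n, Fin (a i)) where
  Adj u v := (v.1 : ℕ) = (u.1 : ℕ) + 1

/-- The column contraction Q″ of `Lgraph`: an arc from the layer-`i` vertex `q`
to every layer-`(i+1)` vertex iff `q < w i`. -/
def Qcol (n : ℕ) (b w : Fin n → ℕ) : Digraph (Σ i : Fin n, Fin (b i)) where
  Adj u v := (v.1 : ℕ) = (u.1 : ℕ) + 1 ∧ (u.2 : ℕ) < w u.1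

/-- The set ζ of diagonal vertices of `Qrow ⊗ Qcol`: both coordinates lie in
the same layer. -/
def diagN (n : ℕ) (a b : Fin n → ℕ) :
    Set ((Σ i : Fin n, Fin (a i)) × (Σ i : Fin n, Fin (b i))) :=
  {v | v.1.1 = v.2.1}

/-- A walk in the tensor product of the two contractions that starts on the diagonal stays on it. -/
theorem layer_eq_of_reflTransGen_tensor {n : ℕ} {a b w : Fin n → ℕ}
    {u v : (Σ i : Fin n, Fin (a i)) × (Σ i : Fin n, Fin (b i))}
    (hu : (u.1.1 : ℕ) = u.2.1)
    (h : Relation.ReflTransGen ((Qrow n a).tensor (Qcol n b w)).Adj u v) :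
    (v.1.1 : ℕ) = v.2.1 := by
  induction h with
  | refl => exact hu
  | tail _ hadj ih =>
    have h₁ := hadj.1
    have h₂ := hadj.2.1
    simp only [Qrow] at h₁
    omega

/-- If every layer but the last has a vertex with outgoing arcs, each diagonal vertex is reachable
from a diagonal vertex of layer zero. -/
theorem exists_layerZero_reflTransGen_tensor {n : ℕ} {a b w : Fin n → ℕ}
    (ha : ∀ i, 1 ≤ a i) (hb : ∀ i, 1 ≤ b i) (hw : ∀ i : Fin n, (i : ℕ) + 1 < n → 1 ≤ w i) (k : ℕ) :
    ∀ v : (Σ i : Fin n, Fin (a i)) × (Σ i : Fin n, Fin (b i)),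
      (v.1.1 : ℕ) = k → (v.2.1 : ℕ) = k →
        ∃ u : (Σ i : Fin n, Fin (a i)) × (Σ i : Fin n, Fin (b i)),
          ((u.1.1 : ℕ) = 0 ∧ (u.2.1 : ℕ) = 0) ∧
          Relation.ReflTransGen ((Qrow n a).tensor (Qcol n b w)).Adj u v := by
  induction k with
  | zero => exact fun v h₁ h₂ => ⟨v, ⟨h₁, h₂⟩, .refl⟩
  | succ k ih =>
    intro v h₁ h₂
    have hk : k + 1 < n := h₁ ▸ v.1.1.isLt
    let i : Fin n := ⟨k, by omega⟩
    obtain ⟨u, hu, huv⟩ := ih (⟨i, ⟨0, ha i⟩⟩, ⟨i, ⟨0, hb i⟩⟩) rfl rfl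
    exact ⟨u, hu, huv.tail ⟨h₁, h₂, hw i hk⟩⟩

theorem diagonal_iff_reachable_from_layerZero_diagonal
    (n : ℕ) (hn : 2 ≤ n) (a b w : Fin n → ℕ)
    (ha : ∀ i, 1 ≤ a i) (hb : ∀ i, 1 ≤ b i)
    (hw0 : w ⟨0, by omega⟩ = b ⟨0, by omega⟩)
    (hw : ∀ i : Fin n, 1 ≤ (i : ℕ) → (i : ℕ) ≤ n - 2 → 1 ≤ w i ∧ w i ≤ b i) :
    ∀ v : (Σ i : Fin n, Fin (a i)) × (Σ i : Fin n, Fin (b i)),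
      v ∈ diagN n a b ↔
        (((v.1.1 : ℕ) = 0 ∧ (v.2.1 : ℕ) = 0) ∨
         ∃ u : (Σ i : Fin n, Fin (a i)) × (Σ i : Fin n, Fin (b i)),
           ((u.1.1 : ℕ) = 0 ∧ (u.2.1 : ℕ) = 0) ∧
           Relation.ReflTransGen ((Qrow n a).tensor (Qcol n b w)).Adj u v) := by
  intro v
  constructor
  · intro hv
    have hpos : ∀ i : Fin n, (i : ℕ) + 1 < n → 1 ≤ w i := by
      intro i hi
      rcases Nat.eq_zero_or_pos (i : ℕ) with h | h
      · rw [show i = ⟨0, by omega⟩ from Fin.ext h, hw0]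
        exact hb _
      · exact (hw i h (by omega)).1
    exact .inr (exists_layerZero_reflTransGen_tensor ha hb hpos _ v rfl
      (congrArg Fin.val (Eq.symm hv)))
  · rintro (⟨h₁, h₂⟩ | ⟨u, ⟨h₁, h₂⟩, h⟩)
    · exact Fin.ext (h₁.trans h₂.symm)
    · exact Fin.ext (layer_eq_of_reflTransGen_tensor (h₁.trans h₂.symm) h)
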